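/- arXiv:2008.07526 — 2 statements merged into one kernel-verified Lean document; each statement's English description precedes it below -/
import Mathlib

section
/- There exists a positive constant C such that ‖K_n^κ‖_{L_1(G)} ≤ C for all n ∈ ℕ_{+}, i.e. the L_1 norms of the Walsh–Kaczmarz Fejér kernels are uniformly bounded. -/
open MeasureTheory Filter
open scoped ENNReal

noncomputable section

namespace WalshKaczmarz

/-- The Walsh group `G`: sequences of elements of `ZMod 2` with coordinatewise
addition modulo 2. -/
abbrev G : Type := ℕ → ZMod 2

instance : MeasurableSpace (ZMod 2) := ⊤

/-- The normalized Haar (product) measure on `G`, realized as the pushforward of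
Lebesgue measure on `[0,1)` under the binary digit expansion map. Each coordinate
is uniformly distributed on `ZMod 2` and coordinates are independent.  -/
def μG : Measure G :=
  Measure.map (fun t : ℝ => fun k : ℕ => ((⌊t * 2 ^ (k + 1)⌋ : ℤ) : ZMod 2))
    (volume.restrict (Set.Ico (0 : ℝ) 1))

/-- The dyadic interval `I_n(x)`. -/
def I (n : ℕ) (x : G) : Set G := {y : G | ∀ k < n, y k = x k}

/-- `e n` : the element of `G` whose `n`-th coordinate is `1` and all others `0`. -/
def e (n : ℕ) : G := fun k => if k = n then 1 else 0

/-- The `k`-th Rademacher function `r_k(x) = (-1)^{x_k}`. -/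
def rademacher (k : ℕ) (x : G) : ℝ := (-1 : ℝ) ^ (x k).val

/-- `|n| = max {j : n_j ≠ 0}`, the order of `n ≥ 1`. -/
def order (n : ℕ) : ℕ := Nat.log 2 n

/-- The Walsh–Paley function `w_n = ∏_k r_k^{n_k}`. -/
def walsh (n : ℕ) (x : G) : ℝ :=
  ∏ k ∈ Finset.range n, (if n.testBit k then rademacher k x else 1)

/-- The Walsh–Kaczmarz function `κ_n`. -/
def kacz (n : ℕ) (x : G) : ℝ :=
  if n = 0 then 1 else
    rademacher (order n) x *
      (-1 : ℝ) ^ (∑ k ∈ Finset.range (order n),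
        (if n.testBit k then (x (order n - 1 - k)).val else 0))

/-- Skvortsov's coordinate transformation `τ_A`. -/
def tau (A : ℕ) (x : G) : G := fun k => if k < A then x (A - 1 - k) else x k

/-- The Walsh–Paley Dirichlet kernel `D_n^w`. -/
def dirW (n : ℕ) (x : G) : ℝ := ∑ k ∈ Finset.range n, walsh k x

/-- The Walsh–Kaczmarz Dirichlet kernel `D_n^κ`. -/
def dirK (n : ℕ) (x : G) : ℝ := ∑ k ∈ Finset.range n, kacz k x

/-- The Walsh–Paley Fejér kernel `K_n^w = (1/n) ∑_{k=0}^n D_k^w`. -/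
def fejW (n : ℕ) (x : G) : ℝ := (1 / (n : ℝ)) * ∑ k ∈ Finset.range (n + 1), dirW k x

/-- The Walsh–Kaczmarz Fejér kernel `K_n^κ = (1/n) ∑_{k=0}^n D_k^κ`. -/
def fejK (n : ℕ) (x : G) : ℝ := (1 / (n : ℝ)) * ∑ k ∈ Finset.range (n + 1), dirK k x

/-- The Walsh–Kaczmarz–Fourier coefficient of an integrable function. -/
def coeffK (f : G → ℝ) (k : ℕ) : ℝ := ∫ x, f x * kacz k x ∂μG

/-- The `n`-th Walsh–Kaczmarz partial sum `S_n^κ f`. -/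
def SK (f : G → ℝ) (n : ℕ) (x : G) : ℝ := ∑ k ∈ Finset.range n, coeffK f k * kacz k x

/-- The `n`-th Walsh–Kaczmarz Fejér mean `σ_n^κ f = (1/n) ∑_{j=0}^n S_j^κ f`. -/
def sigmaK (f : G → ℝ) (n : ℕ) (x : G) : ℝ :=
  (1 / (n : ℝ)) * ∑ j ∈ Finset.range (n + 1), SK f j x

/-- `𝔉_n` : the σ-algebra generated by the dyadic intervals of measure `2^{-n}`. -/
def F (n : ℕ) : MeasurableSpace G := MeasurableSpace.generateFrom {s | ∃ x : G, s = I n x}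

/-- A martingale with respect to the filtration `(𝔉_n)` of dyadic σ-algebras. -/
def IsDyadicMartingale (f : ℕ → G → ℝ) : Prop :=
  (∀ n, Integrable (f n) μG) ∧ (∀ n, StronglyMeasurable[F n] (f n)) ∧
    ∀ n, μG[f (n + 1)|F n] =ᵐ[μG] f n

/-- `‖f‖_{H_p}^p = ∫ (f^*)^p dμ` for a martingale `f`, where `f^* = sup_n |f^{(n)}|`
is the maximal function. -/
def martHpNormP (p : ℝ) (f : ℕ → G → ℝ) : ℝ≥0∞ :=
  ∫⁻ x, (⨆ n, ENNReal.ofReal |f n x|) ^ p ∂μG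

/-- The martingale Hardy norm `‖f‖_{H_p} = ‖f^*‖_{L_p}`. -/
def martHpNorm (p : ℝ) (f : ℕ → G → ℝ) : ℝ≥0∞ := martHpNormP p f ^ (1 / p)

/-- Membership in the martingale Hardy space `H_p(G)`. -/
def MemHp (p : ℝ) (f : ℕ → G → ℝ) : Prop :=
  IsDyadicMartingale f ∧ martHpNormP p f < ∞

/-- The maximal function of an integrable function `g`, i.e. of the martingale
`(S_{2^n} g)`:  `g^*(x) = sup_n (1/μ(I_n(x))) |∫_{I_n(x)} g dμ|`. -/
def funMaximal (g : G → ℝ) (x : G) : ℝ≥0∞ :=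
  ⨆ n : ℕ, ENNReal.ofReal |∫ u in I n x, g u ∂μG| / μG (I n x)

/-- `‖g‖_{H_p}^p` for a function `g`, identified with the martingale `(S_{2^n} g)`. -/
def funHpNormP (p : ℝ) (g : G → ℝ) : ℝ≥0∞ := ∫⁻ x, funMaximal g x ^ p ∂μG

/-- `‖g‖_{L_p}^p = ∫ |g|^p dμ`. -/
def funLpNormP (p : ℝ) (g : G → ℝ) : ℝ≥0∞ := ∫⁻ x, ENNReal.ofReal |g x| ^ p ∂μG

/-- The weak `L_p` quasinorm `‖g‖_{L_{p,∞}} = sup_{λ>0} λ μ({|g|>λ})^{1/p}`. -/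
def weakLpNorm (p : ℝ) (g : G → ℝ) : ℝ≥0∞ :=
  ⨆ (t : ℝ) (_ : 0 < t), ENNReal.ofReal t * μG {x : G | t < |g x|} ^ (1 / p)

/-- The Walsh–Kaczmarz–Fourier coefficient of a martingale:
`f̂(i) = lim_k ∫ f^{(k)} κ_i dμ`. -/
def martCoeffK (f : ℕ → G → ℝ) (i : ℕ) : ℝ :=
  limUnder atTop (fun k => ∫ x, f k x * kacz i x ∂μG)

/-- The `n`-th Walsh–Kaczmarz partial sum of a martingale. -/
def martSK (f : ℕ → G → ℝ) (n : ℕ) (x : G) : ℝ :=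
  ∑ k ∈ Finset.range n, martCoeffK f k * kacz k x

/-- The `n`-th Walsh–Kaczmarz Fejér mean of a martingale. -/
def martSigmaK (f : ℕ → G → ℝ) (n : ℕ) (x : G) : ℝ :=
  (1 / (n : ℝ)) * ∑ j ∈ Finset.range (n + 1), martSK f j x

/-- A `p`-atom supported on the dyadic interval `I_n(x₀)`. -/
def IsPAtomOn (p : ℝ) (n : ℕ) (x₀ : G) (a : G → ℝ) : Prop :=
  Measurable a ∧ (∀ y, y ∉ I n x₀ → a y = 0) ∧ (∫ y in I n x₀, a y ∂μG) = 0 ∧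
    ∀ y, ENNReal.ofReal |a y| ≤ μG (I n x₀) ^ (-(1 / p))

/-- A `p`-atom. -/
def IsPAtom (p : ℝ) (a : G → ℝ) : Prop := ∃ n x₀, IsPAtomOn p n x₀ a

end WalshKaczmarz

namespace WalshKaczmarz

/-! ### The measure of dyadic intervals -/

/-- The binary digit expansion map `[0,1) → G`. -/
def digits (t : ℝ) : G := fun k : ℕ => ((⌊t * 2 ^ (k + 1)⌋ : ℤ) : ZMod 2)

lemma measurable_digits : Measurable digits := by
  refine measurable_pi_iff.2 fun k => ?_
  exact (measurable_from_top (f := fun z : ℤ => (z : ZMod 2))).comp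
    (Int.measurable_floor.comp (measurable_id.mul_const _))

lemma measurableSet_I (n : ℕ) (x : G) : MeasurableSet (I n x) := by
  have h : I n x = ⋂ k, ⋂ _ : k < n, (fun y : G => y k) ⁻¹' {x k} := by
    ext y; simp [I]
  rw [h]
  exact MeasurableSet.iInter fun k => MeasurableSet.iInter fun _ =>
    measurable_pi_apply k MeasurableSpace.measurableSet_top

lemma intCast_zmod_two_eq_iff (m c : ℤ) (a : ZMod 2) :
    (m / 2 = c ∧ (m : ZMod 2) = a) ↔ m = 2 * c + a.val := by
  have ha : ((a.val : ℤ) : ZMod 2) = a := by simp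
  have hlt : a.val < 2 := ZMod.val_lt a
  have hm : (m : ZMod 2) = a ↔ m % 2 = (a.val : ℤ) % 2 := by
    rw [← ha, ZMod.intCast_eq_intCast_iff, ha]; rfl
  rw [hm]
  omega

lemma floor_mul_two_pow (t : ℝ) (n : ℕ) : ⌊t * 2 ^ n⌋ = ⌊t * 2 ^ (n + 1)⌋ / 2 := by
  have h : t * 2 ^ n = t * 2 ^ (n + 1) / (2 : ℕ) := by
    rw [pow_succ]; push_cast; ring
  rw [h, Int.floor_div_natCast]; rfl

lemma exists_digits_mem_I_iff (n : ℕ) (x : G) :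
    ∃ c : ℤ, 0 ≤ c ∧ c + 1 ≤ 2 ^ n ∧
      ∀ t ∈ Set.Ico (0 : ℝ) 1, digits t ∈ I n x ↔ ⌊t * 2 ^ n⌋ = c := by
  induction n with
  | zero =>
    refine ⟨0, le_rfl, by norm_num, fun t ht => ?_⟩
    simpa [I] using ht
  | succ n ih =>
    obtain ⟨c, h0, h1, h⟩ := ih
    have hlt : (x n).val < 2 := ZMod.val_lt _
    refine ⟨2 * c + (x n).val, by omega, by rw [pow_succ]; omega, fun t ht => ?_⟩
    rw [← intCast_zmod_two_eq_iff, ← floor_mul_two_pow, ← h t ht]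
    simp only [I, Set.mem_ofPred_eq, Nat.forall_lt_succ_right, digits]

lemma μG_I (n : ℕ) (x : G) : μG (I n x) = ENNReal.ofReal ((2 ^ n)⁻¹) := by
  obtain ⟨c, h0, h1, h⟩ := exists_digits_mem_I_iff n x
  have hp : (0 : ℝ) < 2 ^ n := by positivity
  have h0' : (0 : ℝ) ≤ c := by exact_mod_cast h0
  have h1' : (c : ℝ) + 1 ≤ 2 ^ n := by exact_mod_cast h1
  have hset : digits ⁻¹' I n x ∩ Set.Ico 0 1 = Set.Ico ((c : ℝ) / 2 ^ n) ((c + 1) / 2 ^ n) := by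
    ext t
    have hf : ⌊t * 2 ^ n⌋ = c ↔ t ∈ Set.Ico ((c : ℝ) / 2 ^ n) ((c + 1) / 2 ^ n) := by
      rw [Int.floor_eq_iff, Set.mem_Ico, div_le_iff₀ hp, lt_div_iff₀ hp]
    constructor
    · rintro ⟨ht, ht'⟩
      exact hf.1 ((h t ht').1 ht)
    · intro ht
      have ht' : t ∈ Set.Ico (0 : ℝ) 1 :=
        ⟨(div_nonneg h0' hp.le).trans ht.1, ht.2.trans_le ((div_le_one hp).2 h1')⟩
      exact ⟨(h t ht').2 (hf.2 ht), ht'⟩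
  change Measure.map digits _ _ = _
  rw [Measure.map_apply measurable_digits (measurableSet_I n x),
    Measure.restrict_apply (measurable_digits (measurableSet_I n x)), hset, Real.volume_Ico]
  congr 1
  field_simp
  ring

/-! ### Functions depending on finitely many coordinates -/

/-- `f` depends only on the coordinates below `N`. -/
def DependsBelow (N : ℕ) (f : G → ℝ) : Prop :=
  ∀ x y : G, (∀ k < N, x k = y k) → f x = f y

/-- Extension of a finite sequence by zeros. -/
def extend {N : ℕ} (v : Fin N → ZMod 2) : G := fun k => if h : k < N then v ⟨k, h⟩ else 0

namespace DependsBelow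

variable {N : ℕ} {f g : G → ℝ}

lemma abs (hf : DependsBelow N f) : DependsBelow N fun x => |f x| :=
  fun x y h => congrArg _ (hf x y h)

lemma mono {M : ℕ} (hf : DependsBelow N f) (h : N ≤ M) : DependsBelow M f :=
  fun x y hxy => hf x y fun k hk => hxy k (hk.trans_le h)

lemma add (hf : DependsBelow N f) (hg : DependsBelow N g) : DependsBelow N fun x => f x + g x :=
  fun x y h => by simp only [hf x y h, hg x y h]

lemma mul (hf : DependsBelow N f) (hg : DependsBelow N g) : DependsBelow N fun x => f x * g x :=
  fun x y h => by simp only [hf x y h, hg x y h]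

lemma const (c : ℝ) : DependsBelow N fun _ => c := fun _ _ _ => rfl

lemma sum {ι : Type*} {s : Finset ι} {F : ι → G → ℝ} (h : ∀ i ∈ s, DependsBelow N (F i)) :
    DependsBelow N fun x => ∑ i ∈ s, F i x :=
  fun x y hxy => Finset.sum_congr rfl fun i hi => h i hi x y hxy

lemma comp_tau (hf : DependsBelow N f) : DependsBelow N fun x => f (tau N x) := by
  intro x y h
  refine hf _ _ fun k hk => ?_
  simp only [tau, if_pos hk]
  exact h _ (by omega)

lemma eq_sum_indicator (hf : DependsBelow N f) :
    f = fun x => ∑ v : Fin N → ZMod 2, (I N (extend v)).indicator (fun _ => f (extend v)) x := by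
  funext x
  rw [Finset.sum_eq_single (fun i : Fin N => x i)]
  · have hx : ∀ k < N, x k = extend (fun i : Fin N => x i) k := fun k hk => by simp [extend, hk]
    rw [Set.indicator_of_mem (show x ∈ I N _ from hx)]
    exact hf _ _ hx
  · intro v _ hv
    refine Set.indicator_of_notMem (fun hx => hv ?_) _
    funext i
    simpa [extend] using (hx i i.2).symm
  · simp

lemma integrable_indicator (N : ℕ) (x : G) (c : ℝ) :
    Integrable ((I N x).indicator fun _ => c) μG := by
  refine (integrable_indicator_iff (measurableSet_I N x)).2 (integrableOn_const ?_)
  rw [μG_I]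
  exact ENNReal.ofReal_ne_top

lemma integrable (hf : DependsBelow N f) : Integrable f μG := by
  rw [hf.eq_sum_indicator]
  exact integrable_finsetSum _ fun v _ => integrable_indicator _ _ _

lemma integral_eq_sum (hf : DependsBelow N f) :
    ∫ x, f x ∂μG = (2 ^ N)⁻¹ * ∑ v : Fin N → ZMod 2, f (extend v) := by
  conv_lhs => rw [hf.eq_sum_indicator]
  rw [integral_finsetSum _ fun v _ => integrable_indicator _ _ _, Finset.mul_sum]
  refine Finset.sum_congr rfl fun v _ => ?_
  rw [integral_indicator_const _ (measurableSet_I _ _), Measure.real, μG_I,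
    ENNReal.toReal_ofReal (by positivity), smul_eq_mul]

lemma integral_comp_tau (hf : DependsBelow N f) :
    ∫ x, f (tau N x) ∂μG = ∫ x, f x ∂μG := by
  rw [hf.comp_tau.integral_eq_sum, hf.integral_eq_sum,
    ← Equiv.sum_comp (Equiv.arrowCongr (Fin.revPerm (n := N)) (Equiv.refl (ZMod 2)))]
  congr 1
  refine Finset.sum_congr rfl fun v _ => hf _ _ fun k hk => ?_
  have hk' : N - 1 - k < N := by omega
  simp only [tau, extend, hk, hk', if_true, dif_pos, Equiv.arrowCongr_apply, Function.comp,
    Equiv.refl_apply]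
  congr 1
  ext
  simp [Fin.revPerm, Fin.rev]
  omega

end DependsBelow

lemma dependsBelow_rademacher {k N : ℕ} (h : k < N) : DependsBelow N (rademacher k) :=
  fun x y hxy => by rw [rademacher, rademacher, hxy k h]

lemma abs_rademacher (k : ℕ) (x : G) : |rademacher k x| = 1 := by
  simp [rademacher]

lemma one_add_rademacher_nonneg (k : ℕ) (x : G) : 0 ≤ 1 + rademacher k x := by
  have := neg_abs_le (rademacher k x)
  rw [abs_rademacher] at this
  linarith

lemma neg_one_pow_val_add_one (a : ZMod 2) : (-1 : ℝ) ^ (a + 1).val = -(-1) ^ a.val := by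
  fin_cases a
  · change (-1 : ℝ) ^ 1 = -(-1) ^ 0
    norm_num
  · change (-1 : ℝ) ^ 0 = -(-1) ^ 1
    norm_num

lemma integral_rademacher_mul {N : ℕ} {f : G → ℝ} (hf : DependsBelow N f) :
    ∫ x, rademacher N x * f x ∂μG = 0 := by
  have hd := (dependsBelow_rademacher N.lt_succ_self).mul (hf.mono N.le_succ)
  rw [hd.integral_eq_sum]
  refine mul_eq_zero_of_right _ (self_eq_neg.1 ?_)
  rw [← Finset.sum_neg_distrib]
  conv_lhs =>
    rw [← Equiv.sum_comp (Equiv.addRight (Pi.single (Fin.last N) (1 : ZMod 2)))]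
  refine Finset.sum_congr rfl fun v _ => ?_
  have hr : rademacher N (extend (v + Pi.single (Fin.last N) 1)) = -rademacher N (extend v) := by
    have hN : (⟨N, N.lt_succ_self⟩ : Fin (N + 1)) = Fin.last N := rfl
    simp only [rademacher, extend, N.lt_succ_self, dif_pos, hN, Pi.add_apply, Pi.single_eq_same]
    exact neg_one_pow_val_add_one _
  have hf' : f (extend (v + Pi.single (Fin.last N) 1)) = f (extend v) := by
    refine hf _ _ fun k hk => ?_
    have hne : (⟨k, hk.trans N.lt_succ_self⟩ : Fin (N + 1)) ≠ Fin.last N := by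
      simp [Fin.ext_iff, hk.ne]
    simp [extend, hk.trans N.lt_succ_self, hne]
  rw [Equiv.coe_addRight, hr, hf', neg_mul]

/-! ### The Walsh–Paley system -/

lemma prod_range_testBit_eq {n M N : ℕ} (hn : n < 2 ^ M) (h : M ≤ N) (x : G) :
    ∏ k ∈ Finset.range M, (if n.testBit k then rademacher k x else 1) =
      ∏ k ∈ Finset.range N, (if n.testBit k then rademacher k x else 1) := by
  refine Finset.prod_subset (Finset.range_mono h) fun k _ hk => ?_
  rw [Finset.mem_range, not_lt] at hk
  rw [Nat.testBit_lt_two_pow (hn.trans_le (Nat.pow_le_pow_right two_pos hk))]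
  simp

lemma walsh_eq_prod {n N : ℕ} (hn : n < 2 ^ N) (x : G) :
    walsh n x = ∏ k ∈ Finset.range N, (if n.testBit k then rademacher k x else 1) := by
  rw [walsh, prod_range_testBit_eq n.lt_two_pow_self (le_max_left n N),
    prod_range_testBit_eq hn (le_max_right n N)]

lemma walsh_two_pow_add {l A : ℕ} (hl : l < 2 ^ A) (x : G) :
    walsh (2 ^ A + l) x = rademacher A x * walsh l x := by
  rw [walsh_eq_prod (N := A + 1) (by rw [pow_succ]; omega), walsh_eq_prod hl,
    Finset.prod_range_succ, Nat.testBit_two_pow_add_eq, Nat.testBit_lt_two_pow hl, mul_comm]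
  congr 1
  refine Finset.prod_congr rfl fun k hk => ?_
  rw [Nat.testBit_two_pow_add_gt (Finset.mem_range.1 hk)]

lemma dependsBelow_walsh {n N : ℕ} (hn : n < 2 ^ N) : DependsBelow N (walsh n) := by
  intro x y hxy
  rw [walsh_eq_prod hn, walsh_eq_prod hn]
  refine Finset.prod_congr rfl fun k hk => ?_
  rw [dependsBelow_rademacher (Finset.mem_range.1 hk) x y hxy]

lemma dependsBelow_dirW {n N : ℕ} (hn : n ≤ 2 ^ N) : DependsBelow N (dirW n) :=
  DependsBelow.sum fun _ hk => dependsBelow_walsh ((Finset.mem_range.1 hk).trans_le hn)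

lemma dirW_two_pow_add {m A : ℕ} (hm : m ≤ 2 ^ A) (x : G) :
    dirW (2 ^ A + m) x = dirW (2 ^ A) x + rademacher A x * dirW m x := by
  rw [dirW, Finset.sum_range_add, dirW, dirW, Finset.mul_sum]
  congr 1
  exact Finset.sum_congr rfl fun l hl =>
    walsh_two_pow_add ((Finset.mem_range.1 hl).trans_le hm) x

lemma dirW_one (x : G) : dirW 1 x = 1 := by simp [dirW, walsh]

lemma dirW_two_pow_succ (A : ℕ) (x : G) :
    dirW (2 ^ (A + 1)) x = (1 + rademacher A x) * dirW (2 ^ A) x := by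
  rw [pow_succ, mul_two, dirW_two_pow_add le_rfl]
  ring

lemma dirW_two_pow_eq_prod (A : ℕ) (x : G) :
    dirW (2 ^ A) x = ∏ k ∈ Finset.range A, (1 + rademacher k x) := by
  induction A with
  | zero => simp [dirW_one]
  | succ A ih => rw [dirW_two_pow_succ, Finset.prod_range_succ, ih, mul_comm]

lemma dirW_two_pow_nonneg (A : ℕ) (x : G) : 0 ≤ dirW (2 ^ A) x := by
  rw [dirW_two_pow_eq_prod]
  exact Finset.prod_nonneg fun k _ => one_add_rademacher_nonneg k x

lemma dirW_two_pow_tau (A : ℕ) (x : G) : dirW (2 ^ A) (tau A x) = dirW (2 ^ A) x := by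
  rw [dirW_two_pow_eq_prod, dirW_two_pow_eq_prod, ← Finset.prod_range_reflect]
  refine Finset.prod_congr rfl fun k hk => ?_
  rw [Finset.mem_range] at hk
  have h1 : A - 1 - k < A := by omega
  have h2 : A - 1 - (A - 1 - k) = k := by omega
  simp only [rademacher, tau, h1, h2, if_true]

lemma integral_one_add_rademacher_mul {N : ℕ} {f : G → ℝ} (hf : DependsBelow N f) :
    ∫ x, (1 + rademacher N x) * f x ∂μG = ∫ x, f x ∂μG := by
  simp only [add_mul, one_mul]
  rw [integral_add hf.integrable
    ((dependsBelow_rademacher N.lt_succ_self).mul (hf.mono N.le_succ)).integrable,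
    integral_rademacher_mul hf, add_zero]

lemma integral_one : ∫ _ : G, (1 : ℝ) ∂μG = 1 := by
  rw [(DependsBelow.const (N := 0) 1).integral_eq_sum]
  simp

lemma integral_dirW_two_pow (A : ℕ) : ∫ x, dirW (2 ^ A) x ∂μG = 1 := by
  induction A with
  | zero => simpa [dirW_one] using integral_one
  | succ A ih =>
    simp only [dirW_two_pow_succ]
    rw [integral_one_add_rademacher_mul (dependsBelow_dirW le_rfl), ih]

/-- The unnormalized Walsh–Paley Fejér kernel `n K_n^w`. -/
def sumDirW (n : ℕ) (x : G) : ℝ := ∑ k ∈ Finset.range (n + 1), dirW k x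

lemma sumDirW_zero (x : G) : sumDirW 0 x = 0 := by simp [sumDirW, dirW]

lemma sumDirW_succ (n : ℕ) (x : G) : sumDirW (n + 1) x = sumDirW n x + dirW (n + 1) x :=
  Finset.sum_range_succ _ _

lemma dependsBelow_sumDirW {n N : ℕ} (hn : n ≤ 2 ^ N) : DependsBelow N (sumDirW n) :=
  DependsBelow.sum fun _ hk =>
    dependsBelow_dirW ((Nat.lt_succ_iff.1 (Finset.mem_range.1 hk)).trans hn)

lemma sumDirW_two_pow_add {m A : ℕ} (hm : m ≤ 2 ^ A) (x : G) :
    sumDirW (2 ^ A + m) x =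
      sumDirW (2 ^ A) x + m * dirW (2 ^ A) x + rademacher A x * sumDirW m x := by
  induction m with
  | zero => simp [sumDirW_zero]
  | succ m ih =>
    rw [← add_assoc, sumDirW_succ, ih (by omega), add_assoc (2 ^ A), dirW_two_pow_add hm,
      sumDirW_succ]
    push_cast
    ring

lemma sumDirW_two_pow_succ (A : ℕ) (x : G) :
    sumDirW (2 ^ (A + 1)) x =
      (1 + rademacher A x) * sumDirW (2 ^ A) x + 2 ^ A * dirW (2 ^ A) x := by
  rw [pow_succ, mul_two, sumDirW_two_pow_add le_rfl]
  push_cast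
  ring

lemma sumDirW_one (x : G) : sumDirW 1 x = 1 := by
  rw [← zero_add 1, sumDirW_succ, sumDirW_zero, zero_add, zero_add, dirW_one]

lemma sumDirW_two_pow_nonneg (A : ℕ) (x : G) : 0 ≤ sumDirW (2 ^ A) x := by
  induction A with
  | zero => simp [sumDirW_one]
  | succ A ih =>
    rw [sumDirW_two_pow_succ]
    exact add_nonneg (mul_nonneg (one_add_rademacher_nonneg A x) ih)
      (mul_nonneg (by positivity) (dirW_two_pow_nonneg A x))

lemma integral_sumDirW_two_pow (A : ℕ) : ∫ x, sumDirW (2 ^ A) x ∂μG = 2 ^ A := by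
  induction A with
  | zero => simpa [sumDirW_one] using integral_one
  | succ A ih =>
    have hS := dependsBelow_sumDirW (le_refl (2 ^ A))
    have hD := dependsBelow_dirW (le_refl (2 ^ A))
    simp only [sumDirW_two_pow_succ]
    rw [integral_add
      (((DependsBelow.const 1).add (dependsBelow_rademacher A.lt_succ_self)).mul
        (hS.mono A.le_succ)).integrable (hD.integrable.const_mul _),
      integral_one_add_rademacher_mul hS, ih, integral_const_mul, integral_dirW_two_pow]
    ring

/-- If `h = f + m D_{2^A} + r_A g` then `‖h‖₁ ≤ ‖f‖₁ + m + ‖g‖₁`. -/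
lemma integral_abs_le_of_decomposition {A m N : ℕ} {h f g : G → ℝ}
    (hf : DependsBelow N f) (hg : DependsBelow N g)
    (hh : ∀ x, h x = f x + m * dirW (2 ^ A) x + rademacher A x * g x) :
    ∫ x, |h x| ∂μG ≤ ∫ x, |f x| ∂μG + m + ∫ x, |g x| ∂μG := by
  have hD := (dependsBelow_dirW (le_refl (2 ^ A))).integrable.const_mul (m : ℝ)
  have hfi := hf.abs.integrable
  have hgi := hg.abs.integrable
  have hfD : Integrable (fun x => |f x| + m * dirW (2 ^ A) x) μG := hfi.add hD
  calc ∫ x, |h x| ∂μG ≤ ∫ x, (|f x| + m * dirW (2 ^ A) x + |g x|) ∂μG := by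
        refine integral_mono_of_nonneg (Eventually.of_forall fun x => abs_nonneg _)
          (hfD.add hgi) (Eventually.of_forall fun x => ?_)
        have hm : 0 ≤ m * dirW (2 ^ A) x := mul_nonneg m.cast_nonneg (dirW_two_pow_nonneg A x)
        calc |h x| ≤ |f x| + |m * dirW (2 ^ A) x| + |rademacher A x * g x| := by
              rw [hh]; exact abs_add_three _ _ _
          _ = |f x| + m * dirW (2 ^ A) x + |g x| := by
              rw [abs_of_nonneg hm, abs_mul, abs_rademacher, one_mul]
    _ = _ := by
        rw [integral_add hfD hgi, integral_add hfi hD, integral_const_mul,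
          integral_dirW_two_pow, mul_one]

lemma exists_eq_two_pow_add {n : ℕ} (hn : n ≠ 0) : ∃ A m, n = 2 ^ A + m ∧ m < 2 ^ A := by
  have h1 := Nat.pow_log_le_self 2 hn
  have h2 := Nat.lt_pow_succ_log_self one_lt_two n
  rw [pow_succ] at h2
  exact ⟨Nat.log 2 n, n - 2 ^ Nat.log 2 n, by omega, by omega⟩

lemma integral_abs_sumDirW_le (n : ℕ) : ∫ x, |sumDirW n x| ∂μG ≤ 2 * n := by
  induction n using Nat.strong_induction_on with
  | _ n ih =>
    rcases eq_or_ne n 0 with rfl | hn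
    · simp [sumDirW_zero]
    obtain ⟨A, m, rfl, hm⟩ := exists_eq_two_pow_add hn
    have hpos : 0 < 2 ^ A := by positivity
    have hrec := integral_abs_le_of_decomposition (dependsBelow_sumDirW (le_refl (2 ^ A)))
      (dependsBelow_sumDirW hm.le) (sumDirW_two_pow_add hm.le)
    simp only [abs_of_nonneg (sumDirW_two_pow_nonneg A _), integral_sumDirW_two_pow] at hrec
    have hih := ih m (by omega)
    have hm' : (m : ℝ) ≤ 2 ^ A := by exact_mod_cast hm.le
    push_cast
    linarith

/-! ### The Walsh–Kaczmarz system -/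

lemma kacz_two_pow_add {l A : ℕ} (hl : l < 2 ^ A) (x : G) :
    kacz (2 ^ A + l) x = rademacher A x * walsh l (tau A x) := by
  have hpos : 0 < 2 ^ A := by positivity
  have hord : order (2 ^ A + l) = A := by
    rw [order, Nat.log_eq_iff (Or.inr ⟨one_lt_two, by omega⟩), pow_succ]
    omega
  rw [kacz, if_neg (by omega), hord, walsh_eq_prod hl, ← Finset.prod_pow_eq_pow_sum]
  congr 1
  refine Finset.prod_congr rfl fun k hk => ?_
  rw [Finset.mem_range] at hk
  rw [Nat.testBit_two_pow_add_gt hk]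
  split_ifs
  · simp only [rademacher, tau, if_pos hk]
  · rfl

lemma dirK_two_pow_add' {m A : ℕ} (hm : m ≤ 2 ^ A) (x : G) :
    dirK (2 ^ A + m) x = dirK (2 ^ A) x + rademacher A x * dirW m (tau A x) := by
  rw [dirK, Finset.sum_range_add, dirK, dirW, Finset.mul_sum]
  congr 1
  exact Finset.sum_congr rfl fun l hl =>
    kacz_two_pow_add ((Finset.mem_range.1 hl).trans_le hm) x

lemma dirK_one (x : G) : dirK 1 x = 1 := by simp [dirK, kacz]

lemma dirK_two_pow (A : ℕ) (x : G) : dirK (2 ^ A) x = dirW (2 ^ A) x := by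
  induction A with
  | zero => simp [dirK_one, dirW_one]
  | succ A ih =>
    rw [dirW_two_pow_succ, pow_succ, mul_two, dirK_two_pow_add' le_rfl, ih, dirW_two_pow_tau]
    ring

lemma dirK_two_pow_add {m A : ℕ} (hm : m ≤ 2 ^ A) (x : G) :
    dirK (2 ^ A + m) x = dirW (2 ^ A) x + rademacher A x * dirW m (tau A x) := by
  rw [dirK_two_pow_add' hm, dirK_two_pow]

/-- The unnormalized Walsh–Kaczmarz Fejér kernel `n K_n^κ`. -/
def sumDirK (n : ℕ) (x : G) : ℝ := ∑ k ∈ Finset.range (n + 1), dirK k x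

lemma sumDirK_succ (n : ℕ) (x : G) : sumDirK (n + 1) x = sumDirK n x + dirK (n + 1) x :=
  Finset.sum_range_succ _ _

lemma sumDirK_one (x : G) : sumDirK 1 x = 1 := by
  rw [← zero_add 1, sumDirK_succ, zero_add, dirK_one]
  simp [sumDirK, dirK]

lemma sumDirK_two_pow_add {m A : ℕ} (hm : m ≤ 2 ^ A) (x : G) :
    sumDirK (2 ^ A + m) x =
      sumDirK (2 ^ A) x + m * dirW (2 ^ A) x + rademacher A x * sumDirW m (tau A x) := by
  induction m with
  | zero => simp [sumDirW_zero]
  | succ m ih =>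
    rw [← add_assoc, sumDirK_succ, ih (by omega), add_assoc (2 ^ A), dirK_two_pow_add hm,
      sumDirW_succ]
    push_cast
    ring

lemma dependsBelow_sumDirK_two_pow (A : ℕ) : DependsBelow A (sumDirK (2 ^ A)) := by
  induction A with
  | zero =>
    intro x y _
    rw [pow_zero, sumDirK_one, sumDirK_one]
  | succ A ih =>
    rw [pow_succ, mul_two, funext (sumDirK_two_pow_add (le_refl (2 ^ A)))]
    exact ((ih.mono A.le_succ).add ((DependsBelow.const _).mul
      ((dependsBelow_dirW le_rfl).mono A.le_succ))).add
      ((dependsBelow_rademacher A.lt_succ_self).mul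
        ((dependsBelow_sumDirW le_rfl).comp_tau.mono A.le_succ))

lemma integral_abs_sumDirK_le {m A : ℕ} (hm : m ≤ 2 ^ A) :
    ∫ x, |sumDirK (2 ^ A + m) x| ∂μG ≤
      ∫ x, |sumDirK (2 ^ A) x| ∂μG + m + ∫ x, |sumDirW m x| ∂μG := by
  have h := integral_abs_le_of_decomposition (dependsBelow_sumDirK_two_pow A)
    (dependsBelow_sumDirW hm).comp_tau (sumDirK_two_pow_add hm)
  rwa [(dependsBelow_sumDirW hm).abs.integral_comp_tau] at h

lemma integral_abs_sumDirK_two_pow_le (A : ℕ) :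
    ∫ x, |sumDirK (2 ^ A) x| ∂μG ≤ 2 * 2 ^ A := by
  induction A with
  | zero =>
    simp only [pow_zero, sumDirK_one, abs_one, integral_one]
    norm_num
  | succ A ih =>
    have h := integral_abs_sumDirK_le (le_refl (2 ^ A))
    simp only [abs_of_nonneg (sumDirW_two_pow_nonneg A _), integral_sumDirW_two_pow] at h
    rw [← mul_two, ← pow_succ] at h
    push_cast at h
    rw [pow_succ (2 : ℝ)]
    linarith

/-- The `L_1(G)` norms of the Walsh–Kaczmarz Fejér kernels are uniformly bounded:
there is a positive constant `C` with `‖K_n^κ‖_1 ≤ C` for all `n ≥ 1`. -/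
theorem fejer_kernel_L1_bounded :
    ∃ C : ℝ, 0 < C ∧ ∀ n : ℕ, 1 ≤ n → (∫ x, |fejK n x| ∂μG) ≤ C := by
  refine ⟨3, by norm_num, fun n hn => ?_⟩
  have hn' : (0 : ℝ) < n := by exact_mod_cast hn
  have hfej : ∀ x, |fejK n x| = 1 / n * |sumDirK n x| := fun x => by
    rw [fejK, abs_mul, abs_of_pos (one_div_pos.2 hn'), sumDirK]
  simp only [hfej]
  rw [integral_const_mul, one_div, inv_mul_le_iff₀ hn']
  obtain ⟨A, m, rfl, hm⟩ := exists_eq_two_pow_add (Nat.one_le_iff_ne_zero.1 hn)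
  have hK := integral_abs_sumDirK_le hm.le
  have hP := integral_abs_sumDirK_two_pow_le A
  have hW := integral_abs_sumDirW_le m
  have hpos : (0 : ℝ) ≤ 2 ^ A := by positivity
  push_cast
  linarith

end WalshKaczmarz
end
end

section
/- Let x ∈ I_2(e_0 + e_1), i.e. x_0 = x_1 = 1. Then for every integer n ≥ 2 one has D_{2^n}(x) = 0, K_{2^n}^κ(x) = 0, and K_{2^{n+1}}^κ(x) − K_{2^n}^κ(x) = 0. -/
open MeasureTheory Filter
open scoped ENNReal

noncomputable section

namespace WalshKaczmarz

/-- Splitting off the two leading digits after the top one: `κ_{2^p b + i}` for `4 ≤ b < 8` and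
`i < 2^p`. -/
theorem kacz_two_pow_mul_add (x : G) {p b i : ℕ} (hb : 4 ≤ b) (hb' : b < 8) (hi : i < 2 ^ p) :
    kacz (2 ^ p * b + i) x =
      rademacher (p + 2) x *
        (-1 : ℝ) ^ (∑ k ∈ Finset.range p, (if i.testBit k then (x (p + 1 - k)).val else 0)) *
        (if b.testBit 0 then rademacher 1 x else 1) *
        (if b.testBit 1 then rademacher 0 x else 1) := by
  have hpos : 0 < 2 ^ p := by positivity
  have horder : order (2 ^ p * b + i) = p + 2 := by
    refine (Nat.log_eq_iff (by simp)).2 ⟨?_, ?_⟩ <;> simp only [pow_add] <;> nlinarith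
  have hne : 2 ^ p * b + i ≠ 0 := by positivity
  have hsum : ∑ k ∈ Finset.range p,
        (if (2 ^ p * b + i).testBit k then (x (p + 2 - 1 - k)).val else 0) =
      ∑ k ∈ Finset.range p, (if i.testBit k then (x (p + 1 - k)).val else 0) := by
    refine Finset.sum_congr rfl fun k hk => ?_
    rw [Nat.testBit_two_pow_mul_add _ hi, if_pos (Finset.mem_range.1 hk)]
    rfl
  have h0 : (2 ^ p * b + i).testBit p = b.testBit 0 := by
    simp [Nat.testBit_two_pow_mul_add _ hi]
  have h1 : (2 ^ p * b + i).testBit (p + 1) = b.testBit 1 := by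
    simp [Nat.testBit_two_pow_mul_add _ hi]
  rw [kacz, if_neg hne, horder, Finset.sum_range_succ, Finset.sum_range_succ, hsum, h0, h1,
    pow_add, pow_add, show p + 2 - 1 - p = 1 by omega, show p + 2 - 1 - (p + 1) = 0 by omega]
  simp only [rademacher]
  split_ifs <;> simp [mul_assoc]

theorem dirK_add (m i : ℕ) (x : G) :
    dirK (m + i) x = dirK m x + ∑ j ∈ Finset.range i, kacz (m + j) x :=
  Finset.sum_range_add _ _ _

/-- Four consecutive blocks of length `N` carrying the values `a, -a, -a, a`: if the Dirichlet
kernel vanishes before them, it vanishes after them and its sum over them is zero. -/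
theorem dirK_blocks {x : G} {M N : ℕ} (a : ℕ → ℝ) (hM : dirK M x = 0)
    (h0 : ∀ i < N, kacz (M + i) x = a i)
    (h1 : ∀ i < N, kacz (M + N + i) x = -a i)
    (h2 : ∀ i < N, kacz (M + N + N + i) x = -a i)
    (h3 : ∀ i < N, kacz (M + N + N + N + i) x = a i) :
    dirK (M + N + N + N + N) x = 0 ∧
      ∑ k ∈ Finset.range (M + N + N + N + N), dirK k x = ∑ k ∈ Finset.range M, dirK k x := by
  have step : ∀ (m : ℕ) (s : ℝ), (∀ i < N, kacz (m + i) x = s * a i) →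
      ∀ i ≤ N, dirK (m + i) x = dirK m x + s * ∑ j ∈ Finset.range i, a j := by
    intro m s h i hi
    rw [dirK_add, Finset.mul_sum]
    congr 1
    exact Finset.sum_congr rfl fun j hj => h j ((Finset.mem_range.1 hj).trans_le hi)
  have e0 := step M 1 (by simpa using h0)
  have e1 := step (M + N) (-1) (by simpa using h1)
  have e2 := step (M + N + N) (-1) (by simpa using h2)
  have e3 := step (M + N + N + N) 1 (by simpa using h3)
  have f0 := e0 N le_rfl
  have f1 := e1 N le_rfl
  have f2 := e2 N le_rfl
  have f3 := e3 N le_rfl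
  refine ⟨by linarith, ?_⟩
  have key : ∑ i ∈ Finset.range N, (dirK (M + i) x + dirK (M + N + i) x +
      dirK (M + N + N + i) x + dirK (M + N + N + N + i) x) = 0 := by
    refine Finset.sum_eq_zero fun i hi => ?_
    have hi' := (Finset.mem_range.1 hi).le
    linarith [e0 i hi', e1 i hi', e2 i hi', e3 i hi']
  simp only [Finset.sum_add_distrib] at key
  simp only [Finset.sum_range_add (fun k => dirK k x)]
  linarith

/-- If `x_0 = x_1 = 1`, then `D_{2^{p+2}}(x)` and the sum of the `D_k(x)`, `k < 2^{p+2}`, vanish. -/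
theorem dirK_two_pow_eq_zero {x : G} (hx0 : rademacher 0 x = -1) (hx1 : rademacher 1 x = -1)
    (p : ℕ) :
    dirK (2 ^ (p + 2)) x = 0 ∧ ∑ k ∈ Finset.range (2 ^ (p + 2)), dirK k x = 0 := by
  induction p with
  | zero =>
    have k0 : kacz 0 x = 1 := by simp [kacz]
    have k1 : kacz 1 x = -1 := by simp [kacz, order, hx0]
    have l2 : Nat.log 2 2 = 1 := by decide
    have l3 : Nat.log 2 3 = 1 := by decide
    have k2 : kacz 2 x = -1 := by simp [kacz, order, l2, hx1]
    have k3 : kacz 3 x = 1 := by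
      simp only [rademacher] at hx0
      simp [kacz, order, l3, hx1, hx0]
    norm_num [dirK, Finset.sum_range_succ, k0, k1, k2, k3]
  | succ p ih =>
    have hpow : 2 ^ (p + 1 + 2) =
        2 ^ (p + 2) + 2 ^ p + 2 ^ p + 2 ^ p + 2 ^ p := by ring
    have hblock := dirK_blocks (N := 2 ^ p) (fun i => kacz (2 ^ p * 4 + i) x) ih.1
      (fun i _ => by rw [show 2 ^ (p + 2) + i = 2 ^ p * 4 + i by ring])
      (fun i hi => by
        rw [show 2 ^ (p + 2) + 2 ^ p + i = 2 ^ p * 5 + i by ring,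
          kacz_two_pow_mul_add x (by norm_num) (by norm_num) hi,
          kacz_two_pow_mul_add x (by norm_num) (by norm_num) hi]
        simp [hx1, Nat.testBit])
      (fun i hi => by
        rw [show 2 ^ (p + 2) + 2 ^ p + 2 ^ p + i = 2 ^ p * 6 + i by ring,
          kacz_two_pow_mul_add x (by norm_num) (by norm_num) hi,
          kacz_two_pow_mul_add x (by norm_num) (by norm_num) hi]
        simp [hx0, Nat.testBit])
      (fun i hi => by
        rw [show 2 ^ (p + 2) + 2 ^ p + 2 ^ p + 2 ^ p + i = 2 ^ p * 7 + i by ring,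
          kacz_two_pow_mul_add x (by norm_num) (by norm_num) hi,
          kacz_two_pow_mul_add x (by norm_num) (by norm_num) hi]
        simp [hx0, hx1, Nat.testBit])
    rw [hpow]
    exact ⟨hblock.1, hblock.2.trans ih.2⟩

/-- For `x ∈ I_2(e_0 + e_1)` (i.e. `x_0 = x_1 = 1`) and every `n ≥ 2`:
`D_{2^n}(x) = 0`, `K_{2^n}^κ(x) = 0` and `K_{2^{n+1}}^κ(x) - K_{2^n}^κ(x) = 0`. -/
theorem kernels_vanish_on_I2 (x : G) (hx : x ∈ I 2 (e 0 + e 1)) (n : ℕ) (hn : 2 ≤ n) :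
    dirK (2 ^ n) x = 0 ∧ fejK (2 ^ n) x = 0 ∧
      fejK (2 ^ (n + 1)) x - fejK (2 ^ n) x = 0 := by
  have hx0 : rademacher 0 x = -1 := by
    rw [rademacher, hx 0 (by norm_num)]
    simp [e, ZMod.val_one]
  have hx1 : rademacher 1 x = -1 := by
    rw [rademacher, hx 1 (by norm_num)]
    simp [e, ZMod.val_one]
  have hfej : ∀ p, fejK (2 ^ (p + 2)) x = 0 := fun p => by
    obtain ⟨hD, hS⟩ := dirK_two_pow_eq_zero hx0 hx1 p
    rw [fejK, Finset.sum_range_succ, hS, hD, add_zero, mul_zero]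
  obtain ⟨p, rfl⟩ := Nat.exists_eq_add_of_le' hn
  refine ⟨(dirK_two_pow_eq_zero hx0 hx1 p).1, hfej p, ?_⟩
  rw [hfej p, show p + 2 + 1 = p + 1 + 2 by ring, hfej (p + 1), sub_zero]

end WalshKaczmarz
end
end
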